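/- There does not exist a pair (b, s) ∈ F(d) with b and s continuous everywhere such that (i) s(x) ≤ t for all x ≥ 0, (ii) R2(b, s; γ) ≤ 0 for all γ ∈ ℝ, and (iii) either s(x₀) < t for some x₀ ≥ 0 or R2(b, s; γ₀) < 0 for some γ₀ ∈ ℝ. (This is the reduced form of Corollary 1: condition (i) states that the length of J(b,s) is at most the length of the usual interval I for every realization of the data, and −R2 is the coverage-probability excess of J(b,s) over that of I; hence I is weakly admissible within the subclass of D with continuous b and s.) -/

import Mathlib

open MeasureTheory Set

/-- Standard normal density. -/
noncomputable def phi (x : ℝ) : ℝ := (Real.sqrt (2 * Real.pi))⁻¹ * Real.exp (-(x ^ 2) / 2)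

/-- Standard normal cumulative distribution function. -/
noncomputable def Phi (x : ℝ) : ℝ := ∫ u in Set.Iic x, phi u

/-- `Psi x y μ v = P(x ≤ Z ≤ y)` for `Z ~ N(μ, v)`. -/
noncomputable def Psi (x y μ v : ℝ) : ℝ :=
  ∫ z in Set.Icc x y, (Real.sqrt (2 * Real.pi * v))⁻¹ * Real.exp (-((z - μ) ^ 2) / (2 * v))

/-- Density of `W = √(Q/m)` where `Q ~ χ²_m`. -/
noncomputable def fW (m : ℕ) (w : ℝ) : ℝ :=
  if 0 < w then
    (2 * ((m : ℝ) / 2) ^ ((m : ℝ) / 2) / Real.Gamma ((m : ℝ) / 2)) * w ^ ((m : ℝ) - 1) *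
      Real.exp (-(m : ℝ) * w ^ 2 / 2)
  else 0

/-- `E(W) = ∫₀^∞ w f_W(w) dw`. -/
noncomputable def EW (m : ℕ) : ℝ := ∫ w in Set.Ioi (0 : ℝ), w * fW m w

/-- The class `F(d)` of pairs `(b, s)`: `b : ℝ → ℝ` odd and bounded, `s : [0,∞) → (0,∞)`
bounded, both continuous except possibly at finitely many points, with `b(x) = 0` for
`|x| ≥ d` and `s(x) = t` for `x ≥ d`. -/
structure MemF (d t : ℝ) (b s : ℝ → ℝ) : Prop where
  b_odd : ∀ x, b (-x) = -b x
  b_bdd : ∃ M : ℝ, ∀ x, |b x| ≤ M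
  s_pos : ∀ x, 0 ≤ x → 0 < s x
  s_bdd : ∃ M : ℝ, ∀ x, 0 ≤ x → s x ≤ M
  b_cont : ∃ S : Finset ℝ, ∀ x ∉ S, ContinuousAt b x
  s_cont : ∃ S : Finset ℝ, ∀ x, 0 ≤ x → x ∉ S → ContinuousAt s x
  b_zero : ∀ x, d ≤ |x| → b x = 0
  s_eq_t : ∀ x, d ≤ x → s x = t

/-- Scaled expected-length excess `R1(b,s;γ)` (it depends on `(b,s)` only through `s`). -/
noncomputable def R1 (m : ℕ) (t d : ℝ) (s : ℝ → ℝ) (γ : ℝ) : ℝ :=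
  (1 / (t * EW m)) *
    ∫ w in Set.Ioi (0 : ℝ),
      (∫ x in (-d)..d, (s |x| - t) * phi (w * x - γ)) * (w ^ 2 * fW m w)

/-- `k†(h, w, γ) = Ψ(−tw, tw; ρ(h−γ), 1−ρ²)`. -/
noncomputable def kdag (t ρ h w γ : ℝ) : ℝ :=
  Psi (-(t * w)) (t * w) (ρ * (h - γ)) (1 - ρ ^ 2)

/-- `k(h, w, γ) = Ψ(b(h/w)w − s(|h|/w)w, b(h/w)w + s(|h|/w)w; ρ(h−γ), 1−ρ²)`. -/
noncomputable def kfun (b s : ℝ → ℝ) (ρ h w γ : ℝ) : ℝ :=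
  Psi (b (h / w) * w - s (|h| / w) * w) (b (h / w) * w + s (|h| / w) * w)
    (ρ * (h - γ)) (1 - ρ ^ 2)

/-- Minus the coverage-probability excess, `R2(b,s;γ)`. -/
noncomputable def R2 (m : ℕ) (t d ρ : ℝ) (b s : ℝ → ℝ) (γ : ℝ) : ℝ :=
  -∫ w in Set.Ioi (0 : ℝ),
      (∫ x in (-d)..d, (kfun b s ρ (w * x) w γ - kdag t ρ (w * x) w γ) * phi (w * x - γ)) *
        (w * fW m w)

lemma phi_eq_gaussianPDFReal : phi = ProbabilityTheory.gaussianPDFReal 0 1 := by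
  ext x
  simp [phi, ProbabilityTheory.gaussianPDFReal]

lemma phi_pos (x : ℝ) : 0 < phi x := by
  unfold phi
  positivity

lemma continuous_phi : Continuous phi := by
  unfold phi
  fun_prop

lemma integrable_phi : Integrable phi := by
  rw [phi_eq_gaussianPDFReal]
  exact ProbabilityTheory.integrable_gaussianPDFReal 0 1

lemma integral_phi : ∫ x, phi x = 1 := by
  rw [phi_eq_gaussianPDFReal]
  exact ProbabilityTheory.integral_gaussianPDFReal_eq_one 0 one_ne_zero

lemma phi_lt_phi {x y : ℝ} (h : |x| < |y|) : phi y < phi x := by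
  have := sq_lt_sq.mpr h
  unfold phi
  gcongr

/-- A centred interval has larger standard normal mass than any other interval of at most the
same length. -/
lemma setIntegral_phi_lt {c r t : ℝ} (hr : 0 < r) (hrt : r ≤ t) (h : c ≠ 0 ∨ r ≠ t) :
    ∫ z in Icc (c - r) (c + r), phi z < ∫ z in Icc (-t) t, phi z := by
  have hi : ∀ a b, IntervalIntegrable phi volume a b := fun a b =>
    continuous_phi.intervalIntegrable a b
  rw [integral_Icc_eq_integral_Ioc, integral_Icc_eq_integral_Ioc,
    ← intervalIntegral.integral_of_le (by linarith), ← intervalIntegral.integral_of_le (by linarith)]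
  have shift : (∫ z in (c - r)..(c + r), phi z) - ∫ z in (-r)..r, phi z =
      ∫ u in (0 : ℝ)..c, (phi (u + r) - phi (u - r)) := by
    have hφ := continuous_phi
    have h₁ : Continuous fun u => phi (u + r) := by fun_prop
    have h₂ : Continuous fun u => phi (u - r) := by fun_prop
    rw [intervalIntegral.integral_sub (h₁.intervalIntegrable _ _) (h₂.intervalIntegrable _ _),
      intervalIntegral.integral_comp_add_right, intervalIntegral.integral_comp_sub_right,
      ← intervalIntegral.integral_add_adjacent_intervals (hi (c - r) (-r)) (hi (-r) (c + r)),
      ← intervalIntegral.integral_add_adjacent_intervals (hi (-r) r) (hi r (c + r)),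
      intervalIntegral.integral_symm (-r) (c - r), zero_add, zero_sub]
    ring
  have hcont : Continuous fun u => phi (u + r) - phi (u - r) := by
    have := continuous_phi
    fun_prop
  have translate : c ≠ 0 → (∫ z in (c - r)..(c + r), phi z) < ∫ z in (-r)..r, phi z := by
    intro hc
    rw [← sub_neg, shift]
    rcases hc.lt_or_gt with hc | hc
    · rw [intervalIntegral.integral_symm, neg_lt_zero]
      refine intervalIntegral.intervalIntegral_pos_of_pos_on (hcont.intervalIntegrable _ _)
        (fun u hu => sub_pos.mpr (phi_lt_phi ?_)) hc
      exact sq_lt_sq.mp (by nlinarith [hu.2])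
    · rw [← neg_pos, ← intervalIntegral.integral_neg]
      refine intervalIntegral.intervalIntegral_pos_of_pos_on (hcont.neg.intervalIntegrable _ _)
        (fun u hu => neg_pos.mpr (sub_neg.mpr (phi_lt_phi ?_))) hc
      exact sq_lt_sq.mp (by nlinarith [hu.1])
  have enlarge : r < t → (∫ z in (-r)..r, phi z) < ∫ z in (-t)..t, phi z := by
    intro hlt
    rw [← intervalIntegral.integral_add_adjacent_intervals (hi (-t) (-r)) (hi (-r) t),
      ← intervalIntegral.integral_add_adjacent_intervals (hi (-r) r) (hi r t)]
    have h₁ : 0 < ∫ z in (-t)..(-r), phi z :=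
      intervalIntegral.intervalIntegral_pos_of_pos (hi _ _) phi_pos (by linarith)
    have h₂ : 0 < ∫ z in r..t, phi z :=
      intervalIntegral.intervalIntegral_pos_of_pos (hi _ _) phi_pos hlt
    linarith
  by_cases hc : c = 0
  · subst hc
    simpa using enlarge (lt_of_le_of_ne hrt (by simpa using h))
  · rcases hrt.eq_or_lt with rfl | hlt
    · exact translate hc
    · exact (translate hc).trans (enlarge hlt)

lemma Psi_eq_setIntegral_gaussianPDFReal (x y μ : ℝ) {v : ℝ} (hv : 0 ≤ v) :
    Psi x y μ v = ∫ z in Icc x y, ProbabilityTheory.gaussianPDFReal μ v.toNNReal z := by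
  simp only [Psi, ProbabilityTheory.gaussianPDFReal, Real.coe_toNNReal v hv]

lemma Psi_nonneg (x y μ v : ℝ) : 0 ≤ Psi x y μ v :=
  integral_nonneg fun _ => by positivity

lemma measurable_Psi {α : Type*} [MeasurableSpace α] {x y μ : α → ℝ} (hx : Measurable x)
    (hy : Measurable y) (hμ : Measurable μ) (v : ℝ) :
    Measurable fun a => Psi (x a) (y a) (μ a) v := by
  have hS : MeasurableSet {p : α × ℝ | x p.1 ≤ p.2 ∧ p.2 ≤ y p.1} :=
    (measurableSet_le (hx.comp measurable_fst) measurable_snd).inter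
      (measurableSet_le measurable_snd (hy.comp measurable_fst))
  have hg : Measurable fun p : α × ℝ => (Real.sqrt (2 * Real.pi * v))⁻¹ *
      Real.exp (-((p.2 - μ p.1) ^ 2) / (2 * v)) := by
    fun_prop
  have := (hg.indicator hS).stronglyMeasurable.integral_prod_right' (ν := volume)
  convert this.measurable using 2 with a
  rw [Psi, ← integral_indicator measurableSet_Icc]
  rfl

/-- The two factorisations of the bivariate normal density with correlation `ρ`. -/
lemma gaussianPDFReal_mul_phi {ρ : ℝ} (hρ : ρ ^ 2 < 1) (u z : ℝ) :
    ProbabilityTheory.gaussianPDFReal (ρ * u) (1 - ρ ^ 2).toNNReal z * phi u =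
      phi z * ProbabilityTheory.gaussianPDFReal (ρ * z) (1 - ρ ^ 2).toNNReal u := by
  have hv : 1 - ρ ^ 2 ≠ 0 := by linarith
  simp only [ProbabilityTheory.gaussianPDFReal, phi, Real.coe_toNNReal _ (sub_nonneg.mpr hρ.le)]
  have : Real.exp (-(z - ρ * u) ^ 2 / (2 * (1 - ρ ^ 2))) * Real.exp (-(u ^ 2) / 2) =
      Real.exp (-(z ^ 2) / 2) * Real.exp (-(u - ρ * z) ^ 2 / (2 * (1 - ρ ^ 2))) := by
    rw [← Real.exp_add, ← Real.exp_add]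
    congr 1
    field_simp
    ring
  linear_combination
    (Real.sqrt (2 * Real.pi * (1 - ρ ^ 2)))⁻¹ * (Real.sqrt (2 * Real.pi))⁻¹ * this

lemma integrable_gaussianPDFReal_mul_phi {ρ : ℝ} (hρ : ρ ^ 2 < 1) (S : Set ℝ) :
    Integrable (fun p : ℝ × ℝ =>
        ProbabilityTheory.gaussianPDFReal (ρ * p.1) (1 - ρ ^ 2).toNNReal p.2 * phi p.1)
      (volume.prod (volume.restrict S)) := by
  have hv : (1 - ρ ^ 2).toNNReal ≠ 0 := by simpa using hρ
  have hm : Measurable fun p : ℝ × ℝ =>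
      ProbabilityTheory.gaussianPDFReal (ρ * p.1) (1 - ρ ^ 2).toNNReal p.2 * phi p.1 := by
    unfold ProbabilityTheory.gaussianPDFReal phi
    fun_prop
  rw [integrable_prod_iff' hm.aestronglyMeasurable]
  simp only [gaussianPDFReal_mul_phi hρ]
  refine ⟨.of_forall fun z => (ProbabilityTheory.integrable_gaussianPDFReal _ _).const_mul _, ?_⟩
  refine integrable_phi.integrableOn.congr (.of_forall fun z => ?_)
  simp_rw [Real.norm_of_nonneg (mul_nonneg (phi_pos z).le
    (ProbabilityTheory.gaussianPDFReal_nonneg _ _ _))]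
  rw [integral_const_mul, ProbabilityTheory.integral_gaussianPDFReal_eq_one _ hv, mul_one]

lemma integrable_Psi_mul_phi {ρ : ℝ} (hρ : ρ ^ 2 < 1) (x y h : ℝ) :
    Integrable fun γ => Psi x y (ρ * (h - γ)) (1 - ρ ^ 2) * phi (h - γ) := by
  refine Integrable.comp_sub_left (f := fun u => Psi x y (ρ * u) (1 - ρ ^ 2) * phi u) ?_ h
  simp_rw [Psi_eq_setIntegral_gaussianPDFReal _ _ _ (sub_nonneg.mpr hρ.le), ← integral_mul_const]
  exact (integrable_gaussianPDFReal_mul_phi hρ (Icc x y)).integral_prod_left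

/-- Integrating the conditional law against the mixing law gives the standard normal marginal. -/
lemma integral_Psi_mul_phi {ρ : ℝ} (hρ : ρ ^ 2 < 1) (x y h : ℝ) :
    ∫ γ, Psi x y (ρ * (h - γ)) (1 - ρ ^ 2) * phi (h - γ) = ∫ z in Icc x y, phi z := by
  have hv : (1 - ρ ^ 2).toNNReal ≠ 0 := by simpa using hρ
  rw [integral_sub_left_eq_self (fun u => Psi x y (ρ * u) (1 - ρ ^ 2) * phi u) volume h]
  simp_rw [Psi_eq_setIntegral_gaussianPDFReal _ _ _ (sub_nonneg.mpr hρ.le), ← integral_mul_const]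
  rw [integral_integral_swap (integrable_gaussianPDFReal_mul_phi hρ (Icc x y))]
  simp_rw [gaussianPDFReal_mul_phi hρ, integral_const_mul,
    ProbabilityTheory.integral_gaussianPDFReal_eq_one _ hv, mul_one]

lemma setIntegral_phi_le_one (S : Set ℝ) : ∫ z in S, phi z ≤ 1 := by
  rw [← integral_phi]
  exact setIntegral_le_integral integrable_phi (.of_forall fun z => (phi_pos z).le)

lemma setIntegral_phi_nonneg (S : Set ℝ) : 0 ≤ ∫ z in S, phi z :=
  integral_nonneg fun z => (phi_pos z).le

lemma fW_pos {m : ℕ} (hm : 0 < m) {w : ℝ} (hw : 0 < w) : 0 < fW m w := by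
  have hm' : (0 : ℝ) < m := by exact_mod_cast hm
  have := Real.Gamma_pos_of_pos (half_pos hm')
  rw [fW, if_pos hw]
  positivity

lemma integrableOn_mul_fW {m : ℕ} (hm : 0 < m) :
    IntegrableOn (fun w => w * fW m w) (Ioi 0) := by
  have hm' : (0 : ℝ) < m := by exact_mod_cast hm
  have h : IntegrableOn (fun w : ℝ => (2 * ((m : ℝ) / 2) ^ ((m : ℝ) / 2) /
      Real.Gamma ((m : ℝ) / 2)) * (w ^ (m : ℝ) * Real.exp (-((m : ℝ) / 2) * w ^ 2))) (Ioi 0) :=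
    (integrableOn_rpow_mul_exp_neg_mul_sq (half_pos hm') (by linarith)).const_mul _
  refine h.congr_fun ?_ measurableSet_Ioi
  intro w (hw : 0 < w)
  simp only [fW, if_pos hw]
  rw [show -(m : ℝ) * w ^ 2 / 2 = -((m : ℝ) / 2) * w ^ 2 by ring, Real.rpow_sub_one hw.ne']
  field_simp

/-- The integration measure for `(w, x)` in the definition of `R2`. -/
noncomputable def stripMeasure (d : ℝ) : Measure (ℝ × ℝ) :=
  (volume.restrict (Ioi 0)).prod (volume.restrict (Ioc (-d) d))

instance (d : ℝ) : SFinite (stripMeasure d) := by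
  unfold stripMeasure
  infer_instance

lemma integrable_weight {m : ℕ} (hm : 0 < m) (d : ℝ) :
    Integrable (fun p : ℝ × ℝ => p.1 * fW m p.1) (stripMeasure d) :=
  Integrable.comp_fst (integrableOn_mul_fW hm) _

lemma ae_stripMeasure_fst_pos (d : ℝ) : ∀ᵐ p ∂stripMeasure d, 0 < p.1 := by
  have h : ∀ᵐ w ∂(volume.restrict (Ioi (0 : ℝ))), 0 < w := ae_restrict_mem measurableSet_Ioi
  exact Measure.quasiMeasurePreserving_fst.ae h

/-- Contribution to the coverage at `γ` of `p = (w, x)`, for an interval with endpoints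
`x p`, `y p`. -/
noncomputable def coverageDensity (m : ℕ) (ρ : ℝ) (x y : ℝ × ℝ → ℝ) (γ : ℝ) (p : ℝ × ℝ) : ℝ :=
  Psi (x p) (y p) (ρ * (p.1 * p.2 - γ)) (1 - ρ ^ 2) * phi (p.1 * p.2 - γ) * (p.1 * fW m p.1)

lemma integrable_coverageDensity_left {ρ : ℝ} (hρ : ρ ^ 2 < 1) (m : ℕ) (x y : ℝ × ℝ → ℝ)
    (p : ℝ × ℝ) : Integrable fun γ => coverageDensity m ρ x y γ p :=
  (integrable_Psi_mul_phi hρ (x p) (y p) (p.1 * p.2)).mul_const _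

lemma integral_coverageDensity {ρ : ℝ} (hρ : ρ ^ 2 < 1) (m : ℕ) (x y : ℝ × ℝ → ℝ) (p : ℝ × ℝ) :
    ∫ γ, coverageDensity m ρ x y γ p = (∫ z in Icc (x p) (y p), phi z) * (p.1 * fW m p.1) := by
  simp only [coverageDensity]
  rw [integral_mul_const, integral_Psi_mul_phi hρ]

lemma integrable_setIntegral_phi_mul_weight {m : ℕ} (hm : 0 < m) (d : ℝ) {x y : ℝ × ℝ → ℝ}
    (hx : Measurable x) (hy : Measurable y) :
    Integrable (fun p => (∫ z in Icc (x p) (y p), phi z) * (p.1 * fW m p.1)) (stripMeasure d) := by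
  refine (integrable_weight hm d).bdd_mul (c := 1) ?_ (.of_forall fun p => ?_)
  · have := measurable_Psi hx hy measurable_const (μ := fun _ => 0) 1
    convert this.aestronglyMeasurable using 2 with p
    simp [Psi, phi]
  · rw [Real.norm_of_nonneg (setIntegral_phi_nonneg _)]
    exact setIntegral_phi_le_one _

lemma integrable_coverageDensity {m : ℕ} (hm : 0 < m) {ρ : ℝ} (hρ : ρ ^ 2 < 1) (d : ℝ)
    {x y : ℝ × ℝ → ℝ} (hx : Measurable x) (hy : Measurable y) :
    Integrable (fun q : ℝ × ℝ × ℝ => coverageDensity m ρ x y q.1 q.2)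
      (volume.prod (stripMeasure d)) := by
  have hm₁ : AEStronglyMeasurable (fun q : ℝ × ℝ × ℝ => coverageDensity m ρ x y q.1 q.2)
      (volume.prod (stripMeasure d)) := by
    unfold coverageDensity
    refine AEStronglyMeasurable.mul (Measurable.aestronglyMeasurable ?_)
      ((integrable_weight hm d).1.comp_snd)
    refine (measurable_Psi (hx.comp measurable_snd) (hy.comp measurable_snd)
      (by fun_prop) _).mul ?_
    exact continuous_phi.measurable.comp (by fun_prop)
  rw [integrable_prod_iff' hm₁]
  refine ⟨.of_forall fun p => integrable_coverageDensity_left hρ m x y p, ?_⟩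
  refine (integrable_setIntegral_phi_mul_weight hm d hx hy).congr ?_
  filter_upwards [ae_stripMeasure_fst_pos d] with p hp
  rw [← integral_coverageDensity hρ]
  refine integral_congr_ae (.of_forall fun γ => (Real.norm_of_nonneg ?_).symm)
  exact mul_nonneg (mul_nonneg (Psi_nonneg _ _ _ _) (phi_pos _).le)
    (mul_nonneg hp.le (fW_pos hm hp).le)

lemma R2_eq_integral {m : ℕ} {t d ρ : ℝ} (hd : 0 < d) {b s : ℝ → ℝ} {γ : ℝ}
    (hi : Integrable (fun p => coverageDensity m ρ
        (fun p => b p.2 * p.1 - s |p.2| * p.1) (fun p => b p.2 * p.1 + s |p.2| * p.1) γ p -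
      coverageDensity m ρ (fun p => -(t * p.1)) (fun p => t * p.1) γ p) (stripMeasure d)) :
    R2 m t d ρ b s γ = -∫ p, (coverageDensity m ρ
        (fun p => b p.2 * p.1 - s |p.2| * p.1) (fun p => b p.2 * p.1 + s |p.2| * p.1) γ p -
      coverageDensity m ρ (fun p => -(t * p.1)) (fun p => t * p.1) γ p) ∂stripMeasure d := by
  unfold stripMeasure at hi ⊢
  rw [R2, integral_prod _ hi]
  congr 1
  refine setIntegral_congr_fun measurableSet_Ioi fun w (hw : 0 < w) => ?_
  rw [intervalIntegral.integral_of_le (by linarith), ← integral_mul_const]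
  congr 1
  ext x
  have h₁ : |w * x| / w = |x| := by rw [abs_mul, abs_of_pos hw, mul_div_cancel_left₀ _ hw.ne']
  simp only [coverageDensity, kfun, kdag, mul_div_cancel_left₀ _ hw.ne', h₁]
  ring

/-- **Corollary 1 (reduced form).** There is no `(b,s) ∈ F(d)` with `b` and `s`
continuous everywhere such that `s(x) ≤ t` for all `x ≥ 0` (the length of `J(b,s)` is
never larger than that of `I`), `R2 ≤ 0` everywhere (coverage never smaller), and
either `s(x₀) < t` for some `x₀ ≥ 0` or `R2(γ₀) < 0` for some `γ₀`. -/
theorem usual_interval_weakly_admissible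
    (m : ℕ) (hm : 0 < m) (t d ρ : ℝ) (ht : 0 < t) (hd : 0 < d)
    (hρ₁ : -1 < ρ) (hρ₂ : ρ < 1) :
    ¬∃ b s : ℝ → ℝ, MemF d t b s ∧ Continuous b ∧ ContinuousOn s (Set.Ici 0) ∧
      (∀ x : ℝ, 0 ≤ x → s x ≤ t) ∧
      (∀ γ : ℝ, R2 m t d ρ b s γ ≤ 0) ∧
      ((∃ x : ℝ, 0 ≤ x ∧ s x < t) ∨ (∃ γ : ℝ, R2 m t d ρ b s γ < 0)) := by
  rintro ⟨b, s, hF, hb, hs, hst, hR, hex⟩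
  have hρ : ρ ^ 2 < 1 := by nlinarith
  have hsabs : Continuous fun x => s |x| := hs.comp_continuous continuous_abs fun x => abs_nonneg x
  set lo : ℝ × ℝ → ℝ := fun p => b p.2 * p.1 - s |p.2| * p.1 with hlo
  set hi : ℝ × ℝ → ℝ := fun p => b p.2 * p.1 + s |p.2| * p.1 with hhi
  have hbm : Continuous fun p : ℝ × ℝ => b p.2 * p.1 := by fun_prop
  have hsm : Continuous fun p : ℝ × ℝ => s |p.2| * p.1 :=
    (hsabs.comp continuous_snd).mul continuous_fst
  have hlom : Measurable lo := (hbm.sub hsm).measurable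
  have hhim : Measurable hi := (hbm.add hsm).measurable
  have hlotm : Measurable fun p : ℝ × ℝ => -(t * p.1) := by fun_prop
  have hhitm : Measurable fun p : ℝ × ℝ => t * p.1 := by fun_prop
  have hint := (integrable_coverageDensity hm hρ d hlom hhim).sub
    (integrable_coverageDensity hm hρ d hlotm hhitm)
  have hgap_int := (integrable_setIntegral_phi_mul_weight hm d hlotm hhitm).sub
    (integrable_setIntegral_phi_mul_weight hm d hlom hhim)
  have hgap : ∀ p : ℝ × ℝ, 0 < p.1 → ¬(b p.2 = 0 ∧ s |p.2| = t) →
      ∫ z in Icc (lo p) (hi p), phi z < ∫ z in Icc (-(t * p.1)) (t * p.1), phi z := by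
    intro p hp hne
    refine setIntegral_phi_lt (mul_pos (hF.s_pos _ (abs_nonneg _)) hp)
      (mul_le_mul_of_nonneg_right (hst _ (abs_nonneg _)) hp.le) ?_
    simpa [hp.ne', imp_iff_not_or] using hne
  have hgap_nonneg : 0 ≤ᵐ[stripMeasure d] fun p =>
      (∫ z in Icc (-(t * p.1)) (t * p.1), phi z) * (p.1 * fW m p.1) -
        (∫ z in Icc (lo p) (hi p), phi z) * (p.1 * fW m p.1) := by
    filter_upwards [ae_stripMeasure_fst_pos d] with p hp
    rw [Pi.zero_apply, ← sub_mul]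
    refine mul_nonneg (sub_nonneg.mpr ?_) (mul_nonneg hp.le (fW_pos hm hp).le)
    by_cases h : b p.2 = 0 ∧ s |p.2| = t
    · simp [hlo, hhi, h.1, h.2]
    · exact (hgap p hp h).le
  have hgap_nonpos : ∫ p, ((∫ z in Icc (-(t * p.1)) (t * p.1), phi z) * (p.1 * fW m p.1) -
        (∫ z in Icc (lo p) (hi p), phi z) * (p.1 * fW m p.1)) ∂stripMeasure d ≤ 0 := by
    have hswap := integral_integral_swap
      (f := fun γ p => coverageDensity m ρ lo hi γ p -
        coverageDensity m ρ (fun p => -(t * p.1)) (fun p => t * p.1) γ p) hint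
    have hpos : 0 ≤ ∫ γ, ∫ p, (coverageDensity m ρ lo hi γ p -
        coverageDensity m ρ (fun p => -(t * p.1)) (fun p => t * p.1) γ p) ∂stripMeasure d := by
      refine integral_nonneg_of_ae ?_
      filter_upwards [hint.prod_right_ae] with γ hγ
      have := R2_eq_integral (γ := γ) hd hγ ▸ hR γ
      simpa using this
    have hinner : ∀ p : ℝ × ℝ, ∫ γ, (coverageDensity m ρ lo hi γ p -
        coverageDensity m ρ (fun p => -(t * p.1)) (fun p => t * p.1) γ p) =
        -((∫ z in Icc (-(t * p.1)) (t * p.1), phi z) * (p.1 * fW m p.1) -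
        (∫ z in Icc (lo p) (hi p), phi z) * (p.1 * fW m p.1)) := by
      intro p
      rw [integral_sub (integrable_coverageDensity_left hρ _ _ _ _)
        (integrable_coverageDensity_left hρ _ _ _ _), integral_coverageDensity hρ,
        integral_coverageDensity hρ]
      ring
    rw [hswap] at hpos
    simp_rw [hinner] at hpos
    rw [integral_neg] at hpos
    linarith
  have hzero := (integral_eq_zero_iff_of_nonneg_ae hgap_nonneg hgap_int).mp
    (le_antisymm hgap_nonpos (integral_nonneg_of_ae hgap_nonneg))
  have hae : ∀ᵐ p ∂stripMeasure d, b p.2 = 0 ∧ s |p.2| = t := by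
    filter_upwards [hzero, ae_stripMeasure_fst_pos d] with p hp hp₀
    by_contra hne
    have := mul_lt_mul_of_pos_right (hgap p hp₀ hne) (mul_pos hp₀ (fW_pos hm hp₀))
    rw [Pi.zero_apply] at hp
    linarith
  have : (ae (volume.restrict (Ioi (0 : ℝ)))).NeBot := by
    rw [ae_neBot, Ne, Measure.restrict_eq_zero]
    simp
  obtain ⟨w, hw⟩ := (Measure.ae_ae_of_ae_prod hae).exists
  have hall : (fun x => (b x, s |x|)) = fun _ => ((0 : ℝ), t) := by
    refine Continuous.ae_eq_iff_eq volume (hb.prodMk hsabs) continuous_const |>.mp ?_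
    filter_upwards [(ae_restrict_iff' measurableSet_Ioc).mp hw] with x hx
    by_cases hxd : d ≤ |x|
    · simp [hF.b_zero x hxd, hF.s_eq_t _ hxd]
    · have := abs_lt.mp (not_le.mp hxd)
      simpa using hx ⟨this.1, this.2.le⟩
  have hb0 : ∀ x, b x = 0 := fun x => congrArg Prod.fst (congrFun hall x)
  have hst' : ∀ x, s |x| = t := fun x => congrArg Prod.snd (congrFun hall x)
  rcases hex with ⟨x, hx, hlt⟩ | ⟨γ, hlt⟩
  · have := hst' x
    rw [abs_of_nonneg hx] at this
    exact hlt.ne this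
  · refine hlt.ne ?_
    rw [R2, setIntegral_eq_zero_of_forall_eq_zero, neg_zero]
    intro w (hw : 0 < w)
    have hk : ∀ x, kfun b s ρ (w * x) w γ = kdag t ρ (w * x) w γ := by
      intro x
      have h₁ : |w * x| / w = |x| := by
        rw [abs_mul, abs_of_pos hw, mul_div_cancel_left₀ _ hw.ne']
      simp only [kfun, kdag, hb0, h₁, hst', zero_mul, zero_sub, zero_add]
    simp [hk]
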